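/- The group cohomology of Q8 with trivial integer coefficients satisfies: H^{2q+1}(Q8, ℤ) = 0 for all q ≥ 0. -/

import Mathlib

open CategoryTheory Limits

namespace Rep

universe u

section FunctionRep

variable (k G V : Type u) [CommRing k] [Group G] [AddCommGroup V] [Module k V]

/-- The representation of `G` on all functions `G → V` by right translation. -/
def functionRepresentation : Representation k G (G → V) where
  toFun g := LinearMap.funLeft k V (· * g)
  map_one' := by ext; simp
  map_mul' _ _ := by ext; simp [mul_assoc]

/-- The `G`-representation of all functions `G → V`, with `G` acting by right translation. -/
abbrev functionRep : Rep k G := Rep.of (functionRepresentation k G V)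

/-- Functions on `G` are coinduced from the trivial subgroup. -/
noncomputable def functionRepIsoCoind :
    coind (⊥ : Subgroup G).subtype (trivial k (⊥ : Subgroup G) V) ≅ functionRep k G V :=
  mkIso <| Representation.Equiv.mk
    { Submodule.subtype _ with
      invFun f := ⟨f, by
        rintro ⟨g, hg⟩ h
        obtain rfl := Subgroup.mem_bot.1 hg
        simp⟩
      left_inv _ := rfl
      right_inv _ := rfl }
    (fun _ => rfl)

lemma isZero_groupCohomology_functionRep (n : ℕ) :
    IsZero (groupCohomology (functionRep k G V) (n + 1)) :=
  (isZero_groupCohomology_succ_of_subsingleton (trivial k (⊥ : Subgroup G) V) n).of_iso <|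
    (groupCohomology.functor k G (n + 1)).mapIso (functionRepIsoCoind k G V).symm ≪≫
      groupCohomology.coindIso _ _

end FunctionRep

section Ker

variable {k G : Type u} [CommRing k] [Group G] {A B C D : Rep k G}

/-- The kernel of a morphism of representations, as a subrepresentation. -/
abbrev ker (f : A ⟶ B) : Rep k G :=
  subrepresentation A (LinearMap.ker f.hom.toLinearMap) fun g x hx => by
    have hx' : f.hom x = 0 := hx
    change f.hom (A.ρ g x) = 0
    rw [hom_comm_apply, hx', map_zero]

/-- A morphism whose composition with `h` vanishes, corestricted to the kernel of `h`. -/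
def kerLift (g : B ⟶ C) (h : C ⟶ D) (w : ∀ x, h.hom (g.hom x) = 0) : B ⟶ ker h :=
  ofHom ⟨g.hom.toLinearMap.codRestrict _ w, fun γ => by
    ext x
    exact hom_comm_apply g γ x⟩

lemma comp_eq_zero_of_forall {f : A ⟶ B} {g : B ⟶ C} (h : ∀ x, g.hom (f.hom x) = 0) :
    f ≫ g = 0 :=
  hom_ext (DFunLike.ext _ _ h)

lemma shortExact_of_injective_of_surjective (S : ShortComplex (Rep k G))
    (hf : Function.Injective S.f.hom) (hfg : ∀ x, S.g.hom x = 0 → ∃ y, S.f.hom y = x)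
    (hg : Function.Surjective S.g.hom) : S.ShortExact where
  exact := by
    apply (forget₂ _ (ModuleCat k)).reflects_exact_of_faithful
    rw [ShortComplex.moduleCat_exact_iff]
    exact hfg
  mono_f := (mono_iff_injective _).2 hf
  epi_g := (epi_iff_surjective _).2 hg

end Ker

end Rep

namespace groupCohomology

universe u

variable {k G : Type u} [CommRing k] [Group G]

lemma isZero_of_shortExact {X : ShortComplex (Rep k G)} (hX : X.ShortExact) (n : ℕ)
    (h₂ : IsZero (groupCohomology X.X₂ (n + 1))) (h₃ : IsZero (groupCohomology X.X₃ n)) :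
    IsZero (groupCohomology X.X₁ (n + 1)) :=
  have := epi_δ_of_isZero hX n h₂
  h₃.of_epi (δ hX n (n + 1) rfl)

lemma isZero_zero_of_forall_eq_zero (A : Rep k G) (h : ∀ x : A, (∀ g, A.ρ g x = x) → x = 0) :
    IsZero (groupCohomology A 0) := by
  refine IsZero.of_iso ?_ (H0Iso A)
  have : Subsingleton A.ρ.invariants :=
    ⟨fun x y => Subtype.ext ((h x x.2).trans (h y y.2).symm)⟩
  exact ModuleCat.isZero_of_subsingleton _

lemma isZero_one_trivial_int (G : Type) [Group G] [Finite G] :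
    IsZero (groupCohomology (Rep.trivial ℤ G ℤ) 1) := by
  refine IsZero.of_iso ?_ (H1IsoOfIsTrivial _)
  have : Subsingleton (Additive G →+ (Rep.trivial ℤ G ℤ)) := by
    refine ⟨fun f g => ?_⟩
    have key (f : Additive G →+ ℤ) (x) : f x = 0 := by
      have h : Nat.card (Additive G) • f x = 0 := by
        rw [← map_nsmul, card_nsmul_eq_zero', map_zero]
      exact (smul_eq_zero.1 h).resolve_left (Nat.card_pos (α := Additive G)).ne'
    ext x
    exact (key f x).trans (key g x).symm
  exact ModuleCat.isZero_of_subsingleton _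

end groupCohomology

namespace QuaternionGroup

open Rep

lemma forall_two_iff {P : QuaternionGroup 2 → Prop} :
    (∀ g, P g) ↔ (P (a 0) ∧ P (a 1) ∧ P (a 2) ∧ P (a 3)) ∧
      P (xa 0) ∧ P (xa 1) ∧ P (xa 2) ∧ P (xa 3) := by
  have h4 (Q : ZMod (2 * 2) → Prop) : (∀ i, Q i) ↔ Q 0 ∧ Q 1 ∧ Q 2 ∧ Q 3 :=
    ⟨fun h => ⟨h 0, h 1, h 2, h 3⟩, fun ⟨h₀, h₁, h₂, h₃⟩ i => by fin_cases i <;> assumption⟩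
  rw [← h4 fun i => P (a i), ← h4 fun i => P (xa i)]
  exact ⟨fun h => ⟨fun _ => h _, fun _ => h _⟩, fun h => by rintro (i | i); exacts [h.1 i, h.2 i]⟩

/-- The differential dual to the generators `x = a 1`, `y = xa 0` of `Q₈`. -/
def diff₀ : (QuaternionGroup 2 → ℤ) →ₗ[ℤ] (QuaternionGroup 2 → ℤ × ℤ) where
  toFun f g := (f (a 1 * g) - f g, f (xa 0 * g) - f g)
  map_add' _ _ := by ext <;> simp <;> ring
  map_smul' _ _ := by ext <;> simp <;> ring

/-- The differential dual to the relations `x² = y²` and `xyx = y` of `Q₈`. -/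
def diff₁ : (QuaternionGroup 2 → ℤ × ℤ) →ₗ[ℤ] (QuaternionGroup 2 → ℤ × ℤ) where
  toFun f g :=
    ((f g).1 + (f (a 1 * g)).1 - (f g).2 - (f (xa 0 * g)).2,
      (f g).1 + (f (xa 1 * g)).1 + (f (a 1 * g)).2 - (f g).2)
  map_add' _ _ := by ext <;> simp <;> ring
  map_smul' _ _ := by ext <;> simp <;> ring

/-- The differential dual to the identity among the relations `x² = y²` and `xyx = y`. -/
def diff₂ : (QuaternionGroup 2 → ℤ × ℤ) →ₗ[ℤ] (QuaternionGroup 2 → ℤ) where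
  toFun f g := (f (a 1 * g)).1 - (f g).1 - (f (xa 1 * g)).2 + (f g).2
  map_add' _ _ := by ext; simp; ring
  map_smul' _ _ := by ext; simp; ring

/-- The sum of the values of a function on `Q₈`. -/
def sumValues : (QuaternionGroup 2 → ℤ) →ₗ[ℤ] ℤ where
  toFun f := ∑ g, f g
  map_add' _ _ := Finset.sum_add_distrib
  map_smul' _ _ := by simp [Finset.mul_sum]

lemma exists_eq_on_two {α : Type*} (v₀ v₁ v₂ v₃ w₀ w₁ w₂ w₃ : α) :
    ∃ f : QuaternionGroup 2 → α,
      (f (a 0) = v₀ ∧ f (a 1) = v₁ ∧ f (a 2) = v₂ ∧ f (a 3) = v₃) ∧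
        f (xa 0) = w₀ ∧ f (xa 1) = w₁ ∧ f (xa 2) = w₂ ∧ f (xa 3) = w₃ :=
  ⟨fun
    | a i => ![v₀, v₁, v₂, v₃] i
    | xa i => ![w₀, w₁, w₂, w₃] i,
    ⟨rfl, rfl, rfl, rfl⟩, rfl, rfl, rfl, rfl⟩

lemma a_one_mul_two :
    ((a 1 * a 0 : QuaternionGroup 2) = a 1 ∧ (a 1 * a 1 : QuaternionGroup 2) = a 2 ∧
      (a 1 * a 2 : QuaternionGroup 2) = a 3 ∧ (a 1 * a 3 : QuaternionGroup 2) = a 0) ∧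
      (a 1 * xa 0 : QuaternionGroup 2) = xa 3 ∧ (a 1 * xa 1 : QuaternionGroup 2) = xa 0 ∧
      (a 1 * xa 2 : QuaternionGroup 2) = xa 1 ∧ (a 1 * xa 3 : QuaternionGroup 2) = xa 2 := by
  decide

lemma xa_zero_mul_two :
    ((xa 0 * a 0 : QuaternionGroup 2) = xa 0 ∧ (xa 0 * a 1 : QuaternionGroup 2) = xa 1 ∧
      (xa 0 * a 2 : QuaternionGroup 2) = xa 2 ∧ (xa 0 * a 3 : QuaternionGroup 2) = xa 3) ∧
      (xa 0 * xa 0 : QuaternionGroup 2) = a 2 ∧ (xa 0 * xa 1 : QuaternionGroup 2) = a 3 ∧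
      (xa 0 * xa 2 : QuaternionGroup 2) = a 0 ∧ (xa 0 * xa 3 : QuaternionGroup 2) = a 1 := by
  decide

lemma xa_one_mul_two :
    ((xa 1 * a 0 : QuaternionGroup 2) = xa 1 ∧ (xa 1 * a 1 : QuaternionGroup 2) = xa 2 ∧
      (xa 1 * a 2 : QuaternionGroup 2) = xa 3 ∧ (xa 1 * a 3 : QuaternionGroup 2) = xa 0) ∧
      (xa 1 * xa 0 : QuaternionGroup 2) = a 1 ∧ (xa 1 * xa 1 : QuaternionGroup 2) = a 2 ∧
      (xa 1 * xa 2 : QuaternionGroup 2) = a 3 ∧ (xa 1 * xa 3 : QuaternionGroup 2) = a 0 := by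
  decide

lemma diff₀_apply (f : QuaternionGroup 2 → ℤ) (g : QuaternionGroup 2) :
    diff₀ f g = (f (a 1 * g) - f g, f (xa 0 * g) - f g) := rfl

lemma diff₁_apply (f : QuaternionGroup 2 → ℤ × ℤ) (g : QuaternionGroup 2) :
    diff₁ f g = ((f g).1 + (f (a 1 * g)).1 - (f g).2 - (f (xa 0 * g)).2,
      (f g).1 + (f (xa 1 * g)).1 + (f (a 1 * g)).2 - (f g).2) := rfl

lemma diff₂_apply (f : QuaternionGroup 2 → ℤ × ℤ) (g : QuaternionGroup 2) :
    diff₂ f g = (f (a 1 * g)).1 - (f g).1 - (f (xa 1 * g)).2 + (f g).2 := rfl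

lemma sumValues_apply (f : QuaternionGroup 2 → ℤ) :
    sumValues f = (f (a 0) + f (a 1) + f (a 2) + f (a 3)) +
      (f (xa 0) + f (xa 1) + f (xa 2) + f (xa 3)) := by
  have huniv : (Finset.univ : Finset (QuaternionGroup 2)) =
      {a 0, a 1, a 2, a 3, xa 0, xa 1, xa 2, xa 3} := by decide
  change ∑ g, f g = _
  rw [huniv]
  repeat rw [Finset.sum_insert (by decide)]
  rw [Finset.sum_singleton]
  ring

lemma diff₁_diff₀ (f : QuaternionGroup 2 → ℤ) : diff₁ (diff₀ f) = 0 := by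
  refine funext (forall_two_iff.2 ?_)
  simp only [diff₁_apply, diff₀_apply, a_one_mul_two, xa_zero_mul_two, xa_one_mul_two]
  refine ⟨⟨?_, ?_, ?_, ?_⟩, ?_, ?_, ?_, ?_⟩ <;> ext <;> simp <;> ring

lemma diff₂_diff₁ (f : QuaternionGroup 2 → ℤ × ℤ) : diff₂ (diff₁ f) = 0 := by
  refine funext (forall_two_iff.2 ?_)
  simp only [diff₂_apply, diff₁_apply, a_one_mul_two, xa_zero_mul_two, xa_one_mul_two]
  refine ⟨⟨?_, ?_, ?_, ?_⟩, ?_, ?_, ?_, ?_⟩ <;> simp <;> ring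

lemma sumValues_diff₂ (f : QuaternionGroup 2 → ℤ × ℤ) : sumValues (diff₂ f) = 0 := by
  simp only [sumValues_apply, diff₂_apply, a_one_mul_two, xa_one_mul_two]
  ring

lemma exists_const_eq (f : QuaternionGroup 2 → ℤ) (hf : diff₀ f = 0) : ∃ n, (fun _ => n) = f := by
  have h := forall_two_iff.1 (congrFun hf)
  simp only [diff₀_apply, a_one_mul_two, xa_zero_mul_two, Pi.zero_apply, Prod.ext_iff,
    Prod.fst_zero, Prod.snd_zero] at h
  refine ⟨f (a 0), funext (forall_two_iff.2 ?_)⟩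
  omega

lemma exists_diff₀_eq (w : QuaternionGroup 2 → ℤ × ℤ) (hw : diff₁ w = 0) : ∃ f, diff₀ f = w := by
  have h := forall_two_iff.1 (congrFun hw)
  simp only [diff₁_apply, a_one_mul_two, xa_zero_mul_two, xa_one_mul_two, Pi.zero_apply,
    Prod.ext_iff, Prod.fst_zero, Prod.snd_zero] at h
  obtain ⟨f, hf⟩ := exists_eq_on_two 0 (w (a 0)).1 ((w (a 0)).1 + (w (a 1)).1)
    ((w (a 0)).1 + (w (a 1)).1 + (w (a 2)).1) (w (a 0)).2 ((w (a 0)).1 + (w (a 1)).2)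
    ((w (a 0)).1 + (w (a 1)).1 + (w (a 2)).2)
    ((w (a 0)).1 + (w (a 1)).1 + (w (a 2)).1 + (w (a 3)).2)
  refine ⟨f, funext (forall_two_iff.2 ?_)⟩
  simp only [diff₀_apply, a_one_mul_two, xa_zero_mul_two, hf, Prod.ext_iff]
  omega

lemma exists_diff₁_eq (w : QuaternionGroup 2 → ℤ × ℤ) (hw : diff₂ w = 0) : ∃ f, diff₁ f = w := by
  have h := forall_two_iff.1 (congrFun hw)
  simp only [diff₂_apply, a_one_mul_two, xa_one_mul_two, Pi.zero_apply] at h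
  obtain ⟨f, hf⟩ := exists_eq_on_two (0, 0) (0, 0) (0, 0)
    ((w (a 2)).1 - (w (xa 2)).1 + (w (a 0)).2 + (w (a 1)).2, 0)
    (-(w (a 0)).1 + (w (xa 0)).1 - (w (a 2)).2, -(w (a 0)).1)
    ((w (a 0)).2, -(w (a 1)).1)
    ((w (a 1)).2, -(w (xa 2)).1 + (w (a 0)).2 + (w (a 1)).2)
    ((w (a 2)).2, -(w (xa 3)).1 + (w (a 1)).2 + (w (a 2)).2)
  refine ⟨f, funext (forall_two_iff.2 ?_)⟩
  simp only [diff₁_apply, a_one_mul_two, xa_zero_mul_two, xa_one_mul_two, hf, Prod.ext_iff]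
  omega

lemma exists_diff₂_eq (r : QuaternionGroup 2 → ℤ) (hr : sumValues r = 0) : ∃ f, diff₂ f = r := by
  rw [sumValues_apply] at hr
  obtain ⟨f, hf⟩ := exists_eq_on_two
    (0, r (a 0) + r (a 1) + r (a 2) + r (a 3)) (-r (a 1) - r (a 2) - r (a 3), 0)
    (-r (a 2) - r (a 3), 0) (-r (a 3), 0)
    (0, 0) (-r (xa 1), 0) (-r (xa 1) - r (xa 2), 0) (r (xa 0), 0)
  refine ⟨f, funext (forall_two_iff.2 ?_)⟩
  simp only [diff₂_apply, a_one_mul_two, xa_one_mul_two, hf]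
  omega

/-- The functions `Q₈ → ℤ`, as a `Q₈`-representation. -/
abbrev Fun₁ : Rep ℤ (QuaternionGroup 2) := functionRep ℤ (QuaternionGroup 2) ℤ

/-- The functions `Q₈ → ℤ × ℤ`, as a `Q₈`-representation. -/
abbrev Fun₂ : Rep ℤ (QuaternionGroup 2) := functionRep ℤ (QuaternionGroup 2) (ℤ × ℤ)

/-- The inclusion of the constant functions. -/
def const : trivial ℤ (QuaternionGroup 2) ℤ ⟶ Fun₁ :=
  ofHom ⟨LinearMap.pi fun _ => LinearMap.id, fun _ => rfl⟩

/-- `diff₀` as a morphism of representations. -/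
def d₀ : Fun₁ ⟶ Fun₂ :=
  ofHom ⟨diff₀, fun _ => by ext; all_goals simp [functionRepresentation, diff₀, mul_assoc]⟩

/-- `diff₁` as a morphism of representations. -/
def d₁ : Fun₂ ⟶ Fun₂ :=
  ofHom ⟨diff₁, fun _ => by ext; all_goals simp [functionRepresentation, diff₁, mul_assoc]⟩

/-- `diff₂` as a morphism of representations. -/
def d₂ : Fun₂ ⟶ Fun₁ :=
  ofHom ⟨diff₂, fun _ => by ext; all_goals simp [functionRepresentation, diff₂, mul_assoc]⟩

/-- `sumValues` as a morphism of representations. -/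
def sum : Fun₁ ⟶ trivial ℤ (QuaternionGroup 2) ℤ :=
  ofHom ⟨sumValues, fun g => LinearMap.ext fun f => by
    change ∑ h, f (h * g) = ∑ h, f h
    exact Equiv.sum_comp (Equiv.mulRight g) f⟩

/-- `0 ⟶ ℤ ⟶ Fun₁ ⟶ ker d₁ ⟶ 0`. -/
def constSequence : ShortComplex (Rep ℤ (QuaternionGroup 2)) :=
  .mk const (kerLift d₀ d₁ diff₁_diff₀) <| by
    refine comp_eq_zero_of_forall fun (n : ℤ) => Subtype.ext (funext fun _ => ?_)
    exact Prod.ext (sub_self n) (sub_self n)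

/-- `0 ⟶ ker d₁ ⟶ Fun₂ ⟶ ker d₂ ⟶ 0`. -/
def kerD₁Sequence : ShortComplex (Rep ℤ (QuaternionGroup 2)) :=
  .mk (subtype _ _ _ : ker d₁ ⟶ Fun₂) (kerLift d₁ d₂ diff₂_diff₁) <|
    comp_eq_zero_of_forall fun f => Subtype.ext f.2

/-- `0 ⟶ ker d₂ ⟶ Fun₂ ⟶ ker sum ⟶ 0`. -/
def kerD₂Sequence : ShortComplex (Rep ℤ (QuaternionGroup 2)) :=
  .mk (subtype _ _ _ : ker d₂ ⟶ Fun₂) (kerLift d₂ sum sumValues_diff₂) <|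
    comp_eq_zero_of_forall fun f => Subtype.ext f.2

/-- `0 ⟶ ker sum ⟶ Fun₁ ⟶ ℤ ⟶ 0`. -/
def kerSumSequence : ShortComplex (Rep ℤ (QuaternionGroup 2)) :=
  .mk (subtype _ _ _ : ker sum ⟶ Fun₁) sum <|
    comp_eq_zero_of_forall fun f => f.2

lemma constSequence_shortExact : constSequence.ShortExact :=
  shortExact_of_injective_of_surjective _ (fun _ _ h => congrFun h (a 0))
    (fun f hf => exists_const_eq f (congrArg Subtype.val hf))
    fun w => (exists_diff₀_eq w.1 w.2).imp fun _ => Subtype.ext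

lemma kerD₁Sequence_shortExact : kerD₁Sequence.ShortExact :=
  shortExact_of_injective_of_surjective _ Subtype.val_injective
    (fun f hf => ⟨⟨f, congrArg Subtype.val hf⟩, rfl⟩)
    fun w => (exists_diff₁_eq w.1 w.2).imp fun _ => Subtype.ext

lemma kerD₂Sequence_shortExact : kerD₂Sequence.ShortExact :=
  shortExact_of_injective_of_surjective _ Subtype.val_injective
    (fun f hf => ⟨⟨f, congrArg Subtype.val hf⟩, rfl⟩)
    fun w => (exists_diff₂_eq w.1 w.2).imp fun _ => Subtype.ext

lemma kerSumSequence_shortExact : kerSumSequence.ShortExact :=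
  shortExact_of_injective_of_surjective _ Subtype.val_injective (fun f hf => ⟨⟨f, hf⟩, rfl⟩)
    fun (n : ℤ) => ⟨fun g => if g = 1 then n else 0, by
      change ∑ g : QuaternionGroup 2, (if g = 1 then n else 0) = n
      simp⟩

open groupCohomology

lemma isZero_groupCohomology_trivial_of_ker_sum (n : ℕ)
    (h : IsZero (groupCohomology (ker sum) n)) :
    IsZero (groupCohomology (trivial ℤ (QuaternionGroup 2) ℤ) (n + 3)) :=
  isZero_of_shortExact constSequence_shortExact _ (isZero_groupCohomology_functionRep ..) <|
    isZero_of_shortExact kerD₁Sequence_shortExact _ (isZero_groupCohomology_functionRep ..) <|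
      isZero_of_shortExact kerD₂Sequence_shortExact _ (isZero_groupCohomology_functionRep ..) h

lemma isZero_groupCohomology_ker_sum_zero : IsZero (groupCohomology (ker sum) 0) := by
  refine isZero_zero_of_forall_eq_zero _ fun f hf => Subtype.ext (funext fun g => ?_)
  have hconst (g) : f.1 g = f.1 1 := by
    have h : f.1 (1 * g) = f.1 1 := congrFun (congrArg Subtype.val (hf g)) 1
    rwa [one_mul] at h
  have hsum : ∑ g, (f.1 : QuaternionGroup 2 → ℤ) g = 0 := LinearMap.mem_ker.1 f.2
  simp only [hconst] at hsum
  rw [hconst]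
  simpa [card] using! hsum

lemma isZero_groupCohomology_trivial_odd (q : ℕ) :
    IsZero (groupCohomology (trivial ℤ (QuaternionGroup 2) ℤ) (2 * q + 1)) := by
  induction q using Nat.twoStepInduction with
  | zero => exact isZero_one_trivial_int _
  | one => exact isZero_groupCohomology_trivial_of_ker_sum _ isZero_groupCohomology_ker_sum_zero
  | more q ih _ =>
    exact isZero_groupCohomology_trivial_of_ker_sum (2 * q + 2) <|
      isZero_of_shortExact kerSumSequence_shortExact _ (isZero_groupCohomology_functionRep ..) ih

end QuaternionGroup

/-- The group cohomology of `Q₈` with trivial integer coefficients vanishes in all odd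
degrees: `H^{2q+1}(Q₈, ℤ) = 0` for all `q ≥ 0`. -/
theorem q8_groupCohomology_odd_eq_zero (q : ℕ) :
    Subsingleton
      (groupCohomology (Rep.trivial ℤ (QuaternionGroup 2) ℤ) (2 * q + 1)) :=
  ModuleCat.subsingleton_of_isZero
    (QuaternionGroup.isZero_groupCohomology_trivial_odd q)
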